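/- arXiv:1511.03229 — 3 statements merged into one kernel-verified Lean document; each statement's English description precedes it below -/
import Mathlib

section
/- Let P and Q be probability distributions over the same countable sample space Ω with Q absolutely continuous with respect to P, and let E ⊆ Ω be an event with P(E) > 0. Then Q(E) ≤ max( 2·D_KL(Q,P) / (−log₂ P(E) + 1), e·√(2·P(E)) ). -/
/-- The pointwise form of the Gibbs variational inequality. -/
lemma mul_add_sub_mul_exp_le_mul_log_div {x y : ℝ} (hx : 0 ≤ x) (hy : 0 ≤ y)
    (hxy : y = 0 → x = 0) (c : ℝ) :
    x * c + x - y * Real.exp c ≤ x * Real.log (x / y) := by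
  rcases hx.eq_or_lt with rfl | hx
  · simp only [zero_mul, zero_add, zero_sub, Left.neg_nonpos_iff]
    positivity
  have hy : 0 < y := hy.lt_of_ne fun h => hx.ne' (hxy h.symm)
  have h := Real.log_le_sub_one_of_pos (show 0 < y * Real.exp c / x by positivity)
  rw [Real.log_div (by positivity) hx.ne', Real.log_mul hy.ne' (by positivity),
    Real.log_exp] at h
  rw [Real.log_div hx.ne' hy.ne']
  have h' := mul_le_mul_of_nonneg_left h hx.le
  have e : x * (y * Real.exp c / x - 1) = y * Real.exp c - x := by field_simp
  linarith

/-- A lower bound for the relative entropy (in nats) in terms of a single event. -/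
lemma mul_log_div_sub_add_le_of_hasSum {Ω : Type*} {P Q : Ω → ℝ}
    (hP0 : ∀ σ, 0 ≤ P σ) (hQ0 : ∀ σ, 0 ≤ Q σ) (hP1 : HasSum P 1) (hQ1 : HasSum Q 1)
    (habs : ∀ σ, P σ = 0 → Q σ = 0) {E : Set Ω} {d p q : ℝ}
    (hd : HasSum (fun σ => Q σ * Real.log (Q σ / P σ)) d)
    (hp : HasSum (E.indicator P) p) (hq : HasSum (E.indicator Q) q)
    (hp0 : 0 < p) (hq0 : 0 < q) :
    q * Real.log (q / p) - q + p ≤ d := by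
  have hexp : Real.exp (Real.log (q / p)) = q / p := Real.exp_log (by positivity)
  have hsum := ((hQ1.sub hP1).add (hq.mul_right (Real.log (q / p)))).sub
    (hp.mul_right (q / p - 1))
  have h := hasSum_le (fun σ => ?_) hsum hd
  · have e : p * (q / p - 1) = q - p := by field_simp
    linarith
  · by_cases hσ : σ ∈ E
    · have := mul_add_sub_mul_exp_le_mul_log_div (hQ0 σ) (hP0 σ) (habs σ) (Real.log (q / p))
      rw [hexp] at this
      simp only [Set.indicator_of_mem hσ]
      linarith
    · have := mul_add_sub_mul_exp_le_mul_log_div (hQ0 σ) (hP0 σ) (habs σ) 0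
      rw [Real.exp_zero] at this
      simp only [Set.indicator_of_notMem hσ]
      linarith

/-- **Lemma (KL bound on event probabilities).** Let `P, Q` be probability distributions
on a countable space `Ω` with `Q` absolutely continuous w.r.t. `P`, and let `E` be an
event with `P(E) > 0`. Writing `dkl = D_KL(Q,P) = Σ_σ Q(σ)·log₂(Q(σ)/P(σ))` (the
convention `0·log₂(0/p) = 0` is automatic for real multiplication), `pE = P(E)` and
`qE = Q(E)`, we have `Q(E) ≤ max( 2·D_KL(Q,P)/(−log₂ P(E) + 1), e·√(2·P(E)) )`. -/
theorem kl_event_probability_bound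
    {Ω : Type*} [Countable Ω]
    (P Q : Ω → ℝ)
    (hP0 : ∀ σ, 0 ≤ P σ) (hQ0 : ∀ σ, 0 ≤ Q σ)
    (hP1 : HasSum P 1) (hQ1 : HasSum Q 1)
    (habs : ∀ σ, P σ = 0 → Q σ = 0)
    (E : Set Ω)
    (dkl : ℝ) (hdkl : HasSum (fun σ => Q σ * Real.logb 2 (Q σ / P σ)) dkl)
    (pE : ℝ) (hpE : HasSum (E.indicator P) pE)
    (qE : ℝ) (hqE : HasSum (E.indicator Q) qE)
    (hpEpos : 0 < pE) :
    qE ≤ max (2 * dkl / (-Real.logb 2 pE + 1)) (Real.exp 1 * Real.sqrt (2 * pE)) := by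
  by_contra! hlt
  obtain ⟨h₁, h₂⟩ := max_lt_iff.mp hlt
  have hq : 0 < qE := lt_of_le_of_lt (by positivity) h₂
  have hp1 : pE ≤ 1 := hasSum_le (fun σ => Set.indicator_le_self' (fun σ _ => hP0 σ) σ) hpE hP1
  have hlog2 : 0 < Real.log 2 := Real.log_pos one_lt_two
  have hlogp : Real.log pE ≤ 0 := Real.log_nonpos hpEpos.le hp1
  have hd : HasSum (fun σ => Q σ * Real.log (Q σ / P σ)) (dkl * Real.log 2) := by
    have h := hdkl.mul_right (Real.log 2)
    simpa only [← Real.log_div_log, mul_assoc, div_mul_cancel₀ _ hlog2.ne'] using h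
  have hkl := mul_log_div_sub_add_le_of_hasSum hP0 hQ0 hP1 hQ1 habs hd hpE hqE hpEpos hq
  have hlogq : 1 + (Real.log 2 + Real.log pE) / 2 ≤ Real.log qE := by
    have h := Real.log_le_log (by positivity) h₂.le
    rwa [Real.log_mul (by positivity) (by positivity), Real.log_exp,
      Real.log_sqrt (by positivity), Real.log_mul two_ne_zero hpEpos.ne'] at h
  rw [Real.log_div hq.ne' hpEpos.ne'] at hkl
  have hden : -Real.logb 2 pE + 1 = (Real.log 2 - Real.log pE) / Real.log 2 := by
    rw [← Real.log_div_log]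
    field_simp
    ring
  rw [hden, div_lt_iff₀ (div_pos (by linarith) hlog2), ← mul_div_assoc, lt_div_iff₀ hlog2] at h₁
  nlinarith [mul_le_mul_of_nonneg_left hlogq hq.le]
end

section
/- There exists a constant C > 0 such that for every Poisson random variable P with parameter λ ≥ 1 and every t ≥ 1, Pr(P ≥ λ + t√λ) ≥ e^{−Ct²}. -/
/-- The Poisson probability mass function with parameter `lam`:
`Pr(P = k) = e^{−lam}·lam^k / k!`. -/
noncomputable def poissonP (lam : ℝ) (k : ℕ) : ℝ :=
  Real.exp (-lam) * lam ^ k / (Nat.factorial k : ℝ)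

lemma factorial_le_exp_one_mul_sqrt {n : ℕ} (hn : n ≠ 0) :
    (n.factorial : ℝ) ≤ Real.exp 1 * √n * (n / Real.exp 1) ^ n := by
  obtain ⟨m, rfl⟩ := Nat.exists_eq_succ_of_ne_zero hn
  have h : Stirling.stirlingSeq (m + 1) ≤ Stirling.stirlingSeq 1 :=
    Stirling.stirlingSeq'_antitone (Nat.zero_le m)
  rw [Stirling.stirlingSeq_one, Stirling.stirlingSeq, div_le_iff₀ (by positivity),
    Real.sqrt_mul (by norm_num)] at h
  refine h.trans_eq ?_
  have h2 : √(2 : ℝ) ≠ 0 := by positivity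
  field_simp

lemma poissonP_nonneg {lam : ℝ} (hlam : 0 ≤ lam) (k : ℕ) : 0 ≤ poissonP lam k := by
  unfold poissonP; positivity

lemma summable_poissonP (lam : ℝ) : Summable (poissonP lam) := by
  refine ((Real.summable_pow_div_factorial lam).mul_left (Real.exp (-lam))).congr fun k => ?_
  rw [poissonP, mul_div_assoc]

/-- Local lower bound for the Poisson mass function, with the Gaussian-type exponent
`(k - lam)² / lam`. -/
lemma exp_div_sqrt_le_poissonP {lam : ℝ} (hlam : 0 < lam) {k : ℕ} (hk : k ≠ 0) :
    Real.exp (-1 - (k - lam) ^ 2 / lam) / √k ≤ poissonP lam k := by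
  have hk0 : (0 : ℝ) < k := by positivity
  have hpow : ((k : ℝ) / lam) ^ k ≤ Real.exp (k * (k / lam - 1)) := by
    rw [Real.exp_nat_mul]
    gcongr
    linarith [Real.add_one_le_exp ((k : ℝ) / lam - 1)]
  have hfact : (k.factorial : ℝ) ≤
      Real.exp 1 * √k * lam ^ k * Real.exp (k * (k / lam - 1)) * Real.exp (-k) := by
    calc (k.factorial : ℝ) ≤ Real.exp 1 * √k * (k / Real.exp 1) ^ k :=
          factorial_le_exp_one_mul_sqrt hk
      _ = Real.exp 1 * √k * lam ^ k * (k / lam) ^ k * Real.exp (-k) := by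
          rw [Real.exp_neg, ← Real.exp_one_pow, div_pow, div_pow]
          field_simp
      _ ≤ _ := by gcongr
  rw [poissonP, div_le_div_iff₀ (by positivity) (by positivity)]
  calc Real.exp (-1 - (k - lam) ^ 2 / lam) * k.factorial
      ≤ Real.exp (-1 - (k - lam) ^ 2 / lam) *
        (Real.exp 1 * √k * lam ^ k * Real.exp (k * (k / lam - 1)) * Real.exp (-k)) := by gcongr
    _ = Real.exp (-1 - (k - lam) ^ 2 / lam + 1 + k * (k / lam - 1) + -k) * lam ^ k * √k := by
        simp only [Real.exp_add]; ring
    _ = Real.exp (-lam) * lam ^ k * √k := by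
        congr 3
        field_simp
        ring

/-- Uniform lower bound for the Poisson mass function on the window
`[lam + t√lam, lam + (t + 2)√lam]`. -/
lemma exp_div_le_poissonP_of_mem_window {lam t : ℝ} (hlam : 1 ≤ lam) (ht : 1 ≤ t) {k : ℕ}
    (hlow : lam + t * √lam ≤ k) (hupp : (k : ℝ) ≤ lam + (t + 2) * √lam) :
    Real.exp (-11 * t ^ 2) / √lam ≤ poissonP lam k := by
  have hs : 1 ≤ √lam := Real.one_le_sqrt.mpr hlam
  have hsq : √lam ^ 2 = lam := Real.sq_sqrt (by linarith)
  have hk0 : (0 : ℝ) < k := by nlinarith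
  have hk : k ≠ 0 := by
    rintro rfl
    simp at hk0
  have hdev : ((k : ℝ) - lam) ^ 2 / lam ≤ 9 * t ^ 2 := by
    rw [div_le_iff₀ (by linarith)]
    calc ((k : ℝ) - lam) ^ 2 ≤ (3 * t * √lam) ^ 2 := by
          gcongr
          · nlinarith
          · nlinarith
      _ = 9 * t ^ 2 * lam := by rw [mul_pow, hsq]; ring
  have hsqrt : √(k : ℝ) ≤ Real.exp (t ^ 2) * √lam := by
    rw [Real.sqrt_le_iff]
    refine ⟨by positivity, ?_⟩
    have hexp : t ^ 2 + 1 ≤ Real.exp (t ^ 2) := Real.add_one_le_exp _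
    calc (k : ℝ) ≤ lam + (t + 2) * √lam := hupp
      _ ≤ (4 * t) * lam := by nlinarith [mul_nonneg (sub_nonneg.2 hs) (sub_nonneg.2 ht)]
      _ ≤ (t ^ 2 + 1) ^ 2 * lam := by
          gcongr
          nlinarith [sq_nonneg (t - 1), sq_nonneg (t ^ 2 - 1)]
      _ ≤ Real.exp (t ^ 2) ^ 2 * lam := by gcongr
      _ = (Real.exp (t ^ 2) * √lam) ^ 2 := by rw [mul_pow, hsq]
  refine le_trans ?_ (exp_div_sqrt_le_poissonP (by linarith) hk)
  rw [div_le_div_iff₀ (by positivity) (by positivity)]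
  calc Real.exp (-11 * t ^ 2) * √k ≤ Real.exp (-11 * t ^ 2) * (Real.exp (t ^ 2) * √lam) := by
        gcongr
    _ = Real.exp (-11 * t ^ 2 + t ^ 2) * √lam := by rw [Real.exp_add]; ring
    _ ≤ Real.exp (-1 - (k - lam) ^ 2 / lam) * √lam := by
        gcongr
        nlinarith

/-- **Lemma (Poisson upper tail lower bound).** There exists a constant `C > 0` such that
for every Poisson random variable with parameter `λ ≥ 1` and every `t ≥ 1`,
`Pr(P ≥ λ + t√λ) ≥ e^{−C·t²}`. -/
theorem poisson_tail_lower_bound :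
    ∃ C : ℝ, 0 < C ∧
      ∀ lam : ℝ, 1 ≤ lam → ∀ t : ℝ, 1 ≤ t →
        Real.exp (-C * t ^ 2)
          ≤ ∑' k : ℕ,
              {k : ℕ | lam + t * Real.sqrt lam ≤ (k : ℝ)}.indicator (poissonP lam) k := by
  refine ⟨11, by norm_num, fun lam hlam t ht => ?_⟩
  have hs : 1 ≤ √lam := Real.one_le_sqrt.mpr hlam
  have hnonneg : 0 ≤ lam + t * √lam := by positivity
  set n := ⌈lam + t * √lam⌉₊
  set m := ⌊√lam⌋₊
  have hn : lam + t * √lam ≤ n := Nat.le_ceil _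
  have hn' : (n : ℝ) < lam + t * √lam + 1 := Nat.ceil_lt_add_one hnonneg
  have hm : (m : ℝ) ≤ √lam := Nat.floor_le (by positivity)
  have hm' : √lam < m + 1 := Nat.lt_floor_add_one _
  have hbound : ∀ k ∈ Finset.Icc n (n + m), Real.exp (-11 * t ^ 2) / √lam ≤
      {k : ℕ | lam + t * √lam ≤ (k : ℝ)}.indicator (poissonP lam) k := by
    intro k hk
    rw [Finset.mem_Icc] at hk
    have h1 : (n : ℝ) ≤ k := by exact_mod_cast hk.1
    have h2 : (k : ℝ) ≤ n + m := by exact_mod_cast hk.2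
    have hlow : lam + t * √lam ≤ k := hn.trans h1
    rw [Set.indicator_of_mem (show k ∈ {k : ℕ | lam + t * √lam ≤ (k : ℝ)} from hlow)]
    exact exp_div_le_poissonP_of_mem_window hlam ht hlow (by linarith)
  have hcard : (Finset.Icc n (n + m)).card = m + 1 := by
    rw [Nat.card_Icc]
    omega
  calc Real.exp (-11 * t ^ 2) = √lam * (Real.exp (-11 * t ^ 2) / √lam) := by field_simp
    _ ≤ (m + 1) * (Real.exp (-11 * t ^ 2) / √lam) := by gcongr
    _ = (Finset.Icc n (n + m)).card • (Real.exp (-11 * t ^ 2) / √lam) := by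
        rw [hcard, nsmul_eq_mul]
        push_cast
        rfl
    _ ≤ ∑ k ∈ Finset.Icc n (n + m),
          {k : ℕ | lam + t * √lam ≤ (k : ℝ)}.indicator (poissonP lam) k :=
        Finset.card_nsmul_le_sum _ _ _ hbound
    _ ≤ _ := ((summable_poissonP lam).indicator _).sum_le_tsum _ fun k _ =>
        Set.indicator_nonneg (fun k _ => poissonP_nonneg (by linarith) k) k
end

section
/- Let D₁ and D₂ be probability distributions on a countable space Ω, and suppose there is a coupling of D₁ and D₂, i.e. a joint distribution of a pair (X, Y) with X ~ D₁ and Y ~ D₂, such that Pr(X = Y) ≥ η. Let T : (Ω × Ω) × (Ω × Ω) → {Left, Right} be any test. Define e_A as the probability that T((X₁, Y₂), (X₃, Y₄)) ≠ Left when X₁, X₃ are drawn i.i.d. from D₁ and Y₂, Y₄ are drawn i.i.d. from D₂, all four independent; and define e_B as the probability that T((Y₁, X₂), (Y₃, X₄)) ≠ Right when Y₁, Y₃ are drawn i.i.d. from D₂ and X₂, X₄ are drawn i.i.d. from D₁, all four independent. Then max(e_A, e_B) ≥ η⁴/2. -/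
theorem HasSum.prod_mul_of_nonneg {α β : Type*} {f : α → ℝ} {g : β → ℝ} {a b : ℝ}
    (hf : HasSum f a) (hg : HasSum g b) (hf0 : ∀ x, 0 ≤ f x) (hg0 : ∀ y, 0 ≤ g y) :
    HasSum (fun z : α × β => f z.1 * g z.2) (a * b) :=
  hf.mul hg (hf.summable.mul_of_nonneg hg.summable hf0 hg0)

/-- **Lemma (lower bound for tests from couplings).** Let `D₁, D₂` be probability
distributions on a countable space `Ω` admitting a coupling `μ` with
`Pr(X = Y) ≥ η` (η ≥ 0). Let `T` be any test receiving two pairs, with output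
`true` = "Left" and `false` = "Right". Let `eA` be the probability that
`T((X₁,Y₂),(X₃,Y₄)) ≠ Left` when `X₁, X₃ ~ D₁` and `Y₂, Y₄ ~ D₂` are independent, and
`eB` the probability that `T((Y₁,X₂),(Y₃,X₄)) ≠ Right` when `Y₁, Y₃ ~ D₂` and
`X₂, X₄ ~ D₁` are independent. Then `max(eA, eB) ≥ η⁴/2`. -/
theorem coupling_test_lower_bound
    {Ω : Type*} [Countable Ω]
    (D₁ D₂ : Ω → ℝ)
    (h₁0 : ∀ x, 0 ≤ D₁ x) (h₂0 : ∀ x, 0 ≤ D₂ x)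
    (h₁1 : HasSum D₁ 1) (h₂1 : HasSum D₂ 1)
    (μ : Ω × Ω → ℝ)
    (hμ0 : ∀ p, 0 ≤ μ p)
    (hμ1 : ∀ x, HasSum (fun y => μ (x, y)) (D₁ x))
    (hμ2 : ∀ y, HasSum (fun x => μ (x, y)) (D₂ y))
    (η : ℝ) (hη : 0 ≤ η)
    (hdiag : η ≤ ∑' x : Ω, μ (x, x))
    (T : (Ω × Ω) × (Ω × Ω) → Bool)
    (eA eB : ℝ)
    (heA : HasSum (fun z : Ω × Ω × Ω × Ω =>
      D₁ z.1 * D₂ z.2.1 * D₁ z.2.2.1 * D₂ z.2.2.2 *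
        (if T ((z.1, z.2.1), (z.2.2.1, z.2.2.2)) = true then 0 else 1)) eA)
    (heB : HasSum (fun z : Ω × Ω × Ω × Ω =>
      D₂ z.1 * D₁ z.2.1 * D₂ z.2.2.1 * D₁ z.2.2.2 *
        (if T ((z.1, z.2.1), (z.2.2.1, z.2.2.2)) = false then 0 else 1)) eB) :
    η ^ 4 / 2 ≤ max eA eB := by
  have hm1 : ∀ x, μ (x, x) ≤ D₁ x := fun x =>
    le_hasSum (hμ1 x) x fun _ _ => hμ0 _
  have hm2 : ∀ x, μ (x, x) ≤ D₂ x := fun x =>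
    le_hasSum (hμ2 x) x fun _ _ => hμ0 _
  have hm0 : ∀ x, 0 ≤ μ (x, x) := fun x => hμ0 _
  have hm : HasSum (fun x => μ (x, x)) (∑' x, μ (x, x)) :=
    (Summable.of_nonneg_of_le hm0 hm1 h₁1.summable).hasSum
  have hm_two := hm.prod_mul_of_nonneg hm hm0 hm0
  have hm_three := hm.prod_mul_of_nonneg hm_two hm0 fun z => mul_nonneg (hm0 _) (hm0 _)
  have hm_four := hm.prod_mul_of_nonneg hm_three hm0
    fun z => mul_nonneg (hm0 _) (mul_nonneg (hm0 _) (hm0 _))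
  have hle := hasSum_le (fun z => ?_) hm_four (heA.add heB)
  · have hpow : η ^ 4 ≤ (∑' x, μ (x, x)) ^ 4 := by gcongr
    have hA := le_max_left eA eB
    have hB := le_max_right eA eB
    linarith
  · obtain ⟨a, b, c, d⟩ := z
    have key : ∀ f g : Ω → ℝ, (∀ x, μ (x, x) ≤ f x) → (∀ x, μ (x, x) ≤ g x) →
        μ (a, a) * (μ (b, b) * (μ (c, c) * μ (d, d))) ≤ f a * g b * f c * g d := by
      intro f g hf hg
      have hf0 : ∀ x, 0 ≤ f x := fun x => (hm0 x).trans (hf x)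
      have hg0 : ∀ x, 0 ≤ g x := fun x => (hm0 x).trans (hg x)
      rw [← mul_assoc, ← mul_assoc]
      exact mul_le_mul (mul_le_mul (mul_le_mul (hf a) (hg b) (hm0 b) (hf0 a)) (hf c) (hm0 c)
        (mul_nonneg (hf0 a) (hg0 b))) (hg d) (hm0 d)
        (mul_nonneg (mul_nonneg (hf0 a) (hg0 b)) (hf0 c))
    cases hT : T ((a, b), (c, d))
    · simpa [hT] using key D₁ D₂ hm1 hm2
    · simpa [hT] using key D₂ D₁ hm2 hm1
end
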